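/- arXiv:1909.03239 — 2 statements merged into one kernel-verified Lean document; each statement's English description precedes it below -/
import Mathlib

section
/- Let K be a field of characteristic zero, c ∈ K, and let p: K⁵ → K⁵ be the explicit piecewise polynomial map (C,N,R,A,P) from the counterexample construction (with Q(x) = x(x−1)(x−2)). Set x₀ = (c,0,0,0,1) and x_{i+1} = p(x_i). Then the sequence of fifth coordinates (x_{5,i})_{i∈ℕ} contains 0 if and only if c is algebraic over ℚ. -/
open Classical in
/-- The piecewise polynomial map `p = (C,N,R,A,P)` of the counterexample
construction, with `Q(t) = t(t−1)(t−2)`. -/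
noncomputable def cmap {K : Type*} [Field K] (v : K × K × K × K × K) :
    K × K × K × K × K :=
  let x1 := v.1; let x2 := v.2.1; let x3 := v.2.2.1; let x4 := v.2.2.2.1
  let x5 := v.2.2.2.2
  let Q : K → K := fun t => t * (t - 1) * (t - 2)
  ( x1,
    if x3 = 0 then x2 + 1 else x2,
    if x3 = 0 then x2 + 1 else if Q (x3 - 3 * x4) ≠ 0 then x3 else x4,
    if x3 = 0 then 0 else if Q (x3 - 3 * x4) ≠ 0 then x4 + 1 else 0,
    if x3 = 0 then 1
    else if Q (x3 - 3 * x4) ≠ 0 then x5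
    else if x3 - 3 * x4 = 0 then x5 * x1
    else if x3 - 3 * x4 = 1 then -(x5 * x1)
    else x5 + 1 )

theorem cmap_reset {K : Type*} [Field K] (c n a P : K) :
    cmap (c, n, 0, a, P) = (c, n + 1, n + 1, 0, 1) := by
  simp [cmap]

theorem cmap_count {K : Type*} [Field K] [CharZero K] (c n P : K) {r a : ℕ}
    (h : 3 * a + 3 ≤ r) :
    cmap (c, n, (r : K), (a : K), P) = (c, n, (r : K), ((a + 1 : ℕ) : K), P) := by
  obtain ⟨m, rfl⟩ := Nat.exists_eq_add_of_le h
  have e : ((3 * a + 3 + m : ℕ) : K) - 3 * (a : K) = ((m + 3 : ℕ) : K) := by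
    push_cast; ring
  have hr : ((3 * a + 3 + m : ℕ) : K) ≠ 0 := Nat.cast_ne_zero.mpr (by omega)
  have h0 : ((m + 3 : ℕ) : K) ≠ 0 := Nat.cast_ne_zero.mpr (by omega)
  have h1 : ((m + 3 : ℕ) : K) - 1 ≠ 0 :=
    sub_ne_zero.mpr (by exact_mod_cast (by omega : m + 3 ≠ 1))
  have h2 : ((m + 3 : ℕ) : K) - 2 ≠ 0 :=
    sub_ne_zero.mpr (by exact_mod_cast (by omega : m + 3 ≠ 2))
  have hQ := mul_ne_zero (mul_ne_zero h0 h1) h2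
  rw [← e] at hQ
  simp only [cmap, if_neg hr, if_pos hQ, Nat.cast_succ]

theorem cmap_digit_zero {K : Type*} [Field K] [CharZero K] (c n P : K) {a : ℕ} (ha : a ≠ 0) :
    cmap (c, n, ((3 * a : ℕ) : K), (a : K), P) = (c, n, (a : K), 0, P * c) := by
  have hr : ((3 * a : ℕ) : K) ≠ 0 := Nat.cast_ne_zero.mpr (by omega)
  have e : ((3 * a : ℕ) : K) - 3 * (a : K) = 0 := by push_cast; ring
  simp only [cmap, e, if_neg hr]
  simp

theorem cmap_digit_one {K : Type*} [Field K] [CharZero K] (c n P : K) (a : ℕ) :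
    cmap (c, n, ((3 * a + 1 : ℕ) : K), (a : K), P) = (c, n, (a : K), 0, -(P * c)) := by
  have hr : ((3 * a + 1 : ℕ) : K) ≠ 0 := Nat.cast_ne_zero.mpr (by omega)
  have e : ((3 * a + 1 : ℕ) : K) - 3 * (a : K) = 1 := by push_cast; ring
  simp only [cmap, e, if_neg hr]
  simp

theorem cmap_digit_two {K : Type*} [Field K] [CharZero K] (c n P : K) (a : ℕ) :
    cmap (c, n, ((3 * a + 2 : ℕ) : K), (a : K), P) = (c, n, (a : K), 0, P + 1) := by
  have hr : ((3 * a + 2 : ℕ) : K) ≠ 0 := Nat.cast_ne_zero.mpr (by omega)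
  have e : ((3 * a + 2 : ℕ) : K) - 3 * (a : K) = 2 := by push_cast; ring
  have h2 : (2 : K) ≠ 1 := by norm_num
  simp only [cmap, e, if_neg hr]
  simp [h2]

/-- `t` lies on the forward orbit of `s` under `cmap`. -/
def CMapReaches {K : Type*} [Field K] (s t : K × K × K × K × K) : Prop :=
  ∃ k : ℕ, cmap^[k] s = t

theorem CMapReaches.refl {K : Type*} [Field K] (s : K × K × K × K × K) : CMapReaches s s :=
  ⟨0, rfl⟩

theorem CMapReaches.trans {K : Type*} [Field K] {s t u : K × K × K × K × K}
    (h : CMapReaches s t) (h' : CMapReaches t u) : CMapReaches s u := by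
  obtain ⟨k, rfl⟩ := h
  obtain ⟨l, rfl⟩ := h'
  exact ⟨l + k, Function.iterate_add_apply _ _ _ _⟩

theorem cmapReaches_of_eq {K : Type*} [Field K] {s t : K × K × K × K × K} (h : cmap s = t) :
    CMapReaches s t :=
  ⟨1, h⟩

theorem cmapReaches_count {K : Type*} [Field K] [CharZero K] (c n P : K) {r : ℕ} :
    ∀ a : ℕ, 3 * a ≤ r → CMapReaches (c, n, (r : K), 0, P) (c, n, (r : K), (a : K), P)
  | 0, _ => by simpa using CMapReaches.refl _
  | a + 1, h => (cmapReaches_count c n P a (by omega)).trans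
      (cmapReaches_of_eq (cmap_count c n P (by omega)))

theorem cmapReaches_digit_zero {K : Type*} [Field K] [CharZero K] (c n P : K) {a : ℕ}
    (ha : a ≠ 0) :
    CMapReaches (c, n, ((3 * a : ℕ) : K), 0, P) (c, n, (a : K), 0, P * c) :=
  (cmapReaches_count c n P a le_rfl).trans (cmapReaches_of_eq (cmap_digit_zero c n P ha))

theorem cmapReaches_digit_one {K : Type*} [Field K] [CharZero K] (c n P : K) (a : ℕ) :
    CMapReaches (c, n, ((3 * a + 1 : ℕ) : K), 0, P) (c, n, (a : K), 0, -(P * c)) :=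
  (cmapReaches_count c n P a (by omega)).trans (cmapReaches_of_eq (cmap_digit_one c n P a))

theorem cmapReaches_digit_two {K : Type*} [Field K] [CharZero K] (c n P : K) (a : ℕ) :
    CMapReaches (c, n, ((3 * a + 2 : ℕ) : K), 0, P) (c, n, (a : K), 0, P + 1) :=
  (cmapReaches_count c n P a (by omega)).trans (cmapReaches_of_eq (cmap_digit_two c n P a))

/-- Reading off all ternary digits terminates. -/
theorem exists_cmapReaches_zero {K : Type*} [Field K] [CharZero K] (c n : K) (r : ℕ) :
    ∀ P : K, ∃ P' : K, CMapReaches (c, n, (r : K), 0, P) (c, n, 0, 0, P') := by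
  induction r using Nat.strong_induction_on with
  | _ r ih =>
    intro P
    rcases Nat.eq_zero_or_pos r with rfl | hr
    · exact ⟨P, by simpa using CMapReaches.refl _⟩
    have key : ∃ P₁ : K,
        CMapReaches (c, n, (r : K), 0, P) (c, n, ((r / 3 : ℕ) : K), 0, P₁) := by
      obtain h | h | h : r = 3 * (r / 3) ∨ r = 3 * (r / 3) + 1 ∨ r = 3 * (r / 3) + 2 := by
        omega
      · have := cmapReaches_digit_zero c n P (a := r / 3) (by omega)
        rw [← h] at this
        exact ⟨_, this⟩
      · have := cmapReaches_digit_one c n P (r / 3)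
        rw [← h] at this
        exact ⟨_, this⟩
      · have := cmapReaches_digit_two c n P (r / 3)
        rw [← h] at this
        exact ⟨_, this⟩
    obtain ⟨P₁, h₁⟩ := key
    obtain ⟨P₂, h₂⟩ := ih (r / 3) (by omega) P₁
    exact ⟨P₂, h₁.trans h₂⟩

/-- The orbit of `(c,0,0,0,1)` processes every positive integer. -/
theorem cmapReaches_start {K : Type*} [Field K] [CharZero K] (c : K) (n : ℕ) :
    CMapReaches (c, 0, 0, 0, 1) (c, ((n + 1 : ℕ) : K), ((n + 1 : ℕ) : K), 0, 1) := by
  induction n with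
  | zero => exact cmapReaches_of_eq (by simp [cmap_reset])
  | succ n ih =>
    obtain ⟨P, hP⟩ := exists_cmapReaches_zero c ((n + 1 : ℕ) : K) (n + 1) 1
    refine (ih.trans hP).trans (cmapReaches_of_eq ?_)
    rw [cmap_reset]
    push_cast
    rfl

/-- `v` is computed from `1` by a finite string of ternary digits, with any positive
integer `m` left over. -/
def CMapComputes {K : Type*} [Field K] (c v : K) : Prop :=
  ∀ m : ℕ, 0 < m → ∃ r : ℕ, 0 < r ∧
    ∀ n : K, CMapReaches (c, n, (r : K), 0, 1) (c, n, (m : K), 0, v)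

theorem cmapComputes_one {K : Type*} [Field K] (c : K) : CMapComputes c 1 :=
  fun m hm => ⟨m, hm, fun _ => CMapReaches.refl _⟩

theorem CMapComputes.mul {K : Type*} [Field K] [CharZero K] {c v : K}
    (h : CMapComputes c v) : CMapComputes c (v * c) := fun m hm =>
  let ⟨r, hr, H⟩ := h (3 * m) (by omega)
  ⟨r, hr, fun n => (H n).trans (cmapReaches_digit_zero c n v (by omega))⟩

theorem CMapComputes.neg_mul {K : Type*} [Field K] [CharZero K] {c v : K}
    (h : CMapComputes c v) : CMapComputes c (-(v * c)) := fun m _ =>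
  let ⟨r, hr, H⟩ := h (3 * m + 1) (by omega)
  ⟨r, hr, fun n => (H n).trans (cmapReaches_digit_one c n v m)⟩

theorem CMapComputes.add_one {K : Type*} [Field K] [CharZero K] {c v : K}
    (h : CMapComputes c v) : CMapComputes c (v + 1) := fun m _ =>
  let ⟨r, hr, H⟩ := h (3 * m + 2) (by omega)
  ⟨r, hr, fun n => (H n).trans (cmapReaches_digit_two c n v m)⟩

theorem CMapComputes.add_natCast {K : Type*} [Field K] [CharZero K] {c v : K}
    (h : CMapComputes c v) (k : ℕ) : CMapComputes c (v + k) := by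
  induction k with
  | zero => simpa using h
  | succ k ih => simpa [add_assoc] using ih.add_one

open Polynomial in
theorem cmapComputes_aeval {K : Type*} [Field K] [CharZero K] (c : K) (q : ℤ[X]) :
    q ≠ 0 → (CMapComputes c (aeval c q) ∨ CMapComputes c (-aeval c q)) ∧
      (q.coeff 0 = 0 → CMapComputes c (aeval c q) ∧ CMapComputes c (-aeval c q)) := by
  induction q using Polynomial.recOnHorner with
  | M0 => exact fun h => absurd rfl h
  | MC p a hp ha ih =>
    intro _
    refine ⟨?_, fun h => absurd h (by simp [hp, ha])⟩
    by_cases h0 : p = 0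
    · subst h0
      obtain ⟨k, hk⟩ : ∃ k : ℕ, a.natAbs = k + 1 :=
        Nat.exists_eq_succ_of_ne_zero (Int.natAbs_ne_zero.mpr ha)
      have h := (cmapComputes_one c).add_natCast k
      obtain h' | h' : a = k + 1 ∨ a = -(k + 1) := by omega
      · left; simpa [h', add_comm] using h
      · right; simpa [h', add_comm] using h
    · obtain ⟨h₁, h₂⟩ := (ih h0).2 hp
      obtain ⟨k, h' | h'⟩ := a.eq_nat_or_neg
      · left; simpa [h'] using h₁.add_natCast k
      · right; simpa [h', add_comm] using h₂.add_natCast k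
  | MX p hp ih =>
    intro _
    have key : CMapComputes c (aeval c (p * X)) ∧ CMapComputes c (-aeval c (p * X)) := by
      simp only [map_mul, aeval_X]
      obtain h | h := (ih hp).1
      · exact ⟨h.mul, h.neg_mul⟩
      · exact ⟨by simpa using h.neg_mul, by simpa using h.mul⟩
    exact ⟨Or.inl key.1, fun _ => key⟩

open Polynomial in
/-- States whose middle coordinates are natural numbers and whose last coordinate is the
value at `c` of an integer polynomial that is nonconstant or a positive constant. -/
def CMapInvariant {K : Type*} [Field K] (c : K) (s : K × K × K × K × K) : Prop :=
  ∃ (n r a : ℕ) (p : ℤ[X]), s = (c, (n : K), (r : K), (a : K), aeval c p) ∧ 3 * a ≤ r ∧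
    (0 < p.natDegree ∨ ∃ k : ℕ, p = C ((k : ℤ) + 1))

open Polynomial in
theorem CMapInvariant.cmap {K : Type*} [Field K] [CharZero K] {c : K}
    {s : K × K × K × K × K} (h : CMapInvariant c s) : CMapInvariant c (cmap s) := by
  obtain ⟨n, r, a, p, rfl, har, hp⟩ := h
  have hp0 : p ≠ 0 := by
    rintro rfl
    obtain h | ⟨k, hk⟩ := hp
    · simp at h
    · have := congrArg (coeff · 0) hk
      simp at this
      omega
  rcases Nat.eq_zero_or_pos r with rfl | hr
  · refine ⟨n + 1, n + 1, 0, 1, ?_, by omega, Or.inr ⟨0, by simp⟩⟩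
    rw [Nat.cast_zero, cmap_reset]
    simp
  by_cases h3 : 3 * a + 3 ≤ r
  · exact ⟨n, r, a + 1, p, cmap_count c n _ h3, by omega, hp⟩
  obtain rfl | rfl | rfl : r = 3 * a ∨ r = 3 * a + 1 ∨ r = 3 * a + 2 := by omega
  · refine ⟨n, a, 0, p * X, ?_, by omega, Or.inl ?_⟩
    · rw [cmap_digit_zero c n _ (by omega)]
      simp
    · rw [natDegree_mul_X hp0]
      omega
  · refine ⟨n, a, 0, -(p * X), ?_, by omega, Or.inl ?_⟩
    · rw [cmap_digit_one]
      simp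
    · rw [natDegree_neg, natDegree_mul_X hp0]
      omega
  · refine ⟨n, a, 0, p + 1, ?_, by omega, hp.imp (fun h => ?_) ?_⟩
    · rw [cmap_digit_two]
      simp
    · rwa [← C_1, natDegree_add_C]
    · rintro ⟨k, rfl⟩
      exact ⟨k + 1, by simp⟩

theorem CMapInvariant.isAlgebraic {K : Type*} [Field K] {c : K}
    {s : K × K × K × K × K} (h : CMapInvariant c s) (hs : s.2.2.2.2 = 0) :
    IsAlgebraic ℤ c := by
  obtain ⟨n, r, a, p, rfl, -, hp⟩ := h
  refine ⟨p, ?_, hs⟩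
  rintro rfl
  obtain h | ⟨k, hk⟩ := hp
  · simp at h
  · have := congrArg (Polynomial.coeff · 0) hk
    simp at this
    omega

/-- For the orbit of `(c,0,0,0,1)` under the piecewise polynomial map `p`, the
sequence of fifth coordinates contains `0` iff `c` is algebraic over `ℚ`. -/
theorem stmt14 (K : Type*) [Field K] [CharZero K] (c : K)
    (x : ℕ → K × K × K × K × K)
    (h0 : x 0 = (c, 0, 0, 0, 1))
    (hstep : ∀ i, x (i + 1) = cmap (x i)) :
    (∃ i, (x i).2.2.2.2 = 0) ↔ IsAlgebraic ℚ c := by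
  rw [← IsFractionRing.isAlgebraic_iff ℤ ℚ K]
  constructor
  · rintro ⟨i, hi⟩
    suffices CMapInvariant c (x i) from this.isAlgebraic hi
    clear hi
    induction i with
    | zero => exact ⟨0, 0, 0, 1, by simp [h0], by omega, Or.inr ⟨0, by simp⟩⟩
    | succ i ih => exact hstep i ▸ ih.cmap
  · rintro ⟨q, hq, hqc⟩
    have h : CMapComputes c 0 := by
      simpa [hqc] using (cmapComputes_aeval c q hq).1
    obtain ⟨r, hr, H⟩ := h 1 one_pos
    obtain ⟨m, rfl⟩ := Nat.exists_eq_succ_of_ne_zero hr.ne'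
    obtain ⟨k, hk⟩ := (cmapReaches_start c m).trans (H _)
    have hx : ∀ i, x i = cmap^[i] (x 0) := by
      intro i
      induction i with
      | zero => rfl
      | succ i ih => rw [hstep, ih, Function.iterate_succ_apply']
    exact ⟨k, by rw [hx, h0, hk]⟩
end

section
/- There exists a finite set F of difference polynomials over the algebraic closure of ℚ (in finitely many difference variables) and a difference polynomial g such that g vanishes on every solution of F = 0 in sequences over the algebraic closure of ℚ, but g does not lie in the radical of the difference ideal generated by F; equivalently, I(V(F)) strictly contains √⟨σ^i(F) : i ∈ ℕ⟩. -/
/-- Read one letter of a binary word. The state `(a, w, v)` starts at `(0, 1, -1)`; the letter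
`false` moves `w` along `1, -1, c, -c, c ^ 2, …`, and the letter `true` adds `w` to `a`. -/
def readLetter {R : Type*} [CommRing R] (c : R) (s : R × R × R) : Bool → R × R × R
  | true => (s.1 + s.2.1, s.2.1, s.2.2)
  | false => (s.1, s.2.2, c * s.2.1)

/-- The state before any letter has been read. -/
def startState (R : Type*) [CommRing R] : R × R × R := (0, 1, -1)

/-- The quantity which has to be invertible once a word has been read. -/
def testValue {R : Type*} [CommRing R] (s : R × R × R) : R := s.1 + 2 * s.2.1 + s.2.2

/-- A run of the machine which enumerates all positive integers `n`, decodes each of them as a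
binary word (halving `m` by repeated subtraction, with quotient accumulated in `q`), and checks
that `testValue` is nonzero after the word has been read. -/
structure IsRun {K : Type*} [Field K] (c : K) (n m q : ℕ → K) (s : ℕ → K × K × K) : Prop where
  halve : ∀ k, m k ≠ 0 → m k ≠ 1 →
    n (k + 1) = n k ∧ m (k + 1) = m k - 2 ∧ q (k + 1) = q k + 1 ∧ s (k + 1) = s k
  even : ∀ k, m k = 0 →
    n (k + 1) = n k ∧ m (k + 1) = q k ∧ q (k + 1) = 0 ∧ s (k + 1) = readLetter c (s k) false
  odd : ∀ k, m k = 1 → q k ≠ 0 →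
    n (k + 1) = n k ∧ m (k + 1) = q k ∧ q (k + 1) = 0 ∧ s (k + 1) = readLetter c (s k) true
  finish : ∀ k, m k = 1 → q k = 0 →
    n (k + 1) = n k + 1 ∧ m (k + 1) = n k + 1 ∧ q (k + 1) = 0 ∧ s (k + 1) = startState K
  test_ne_zero : ∀ k, m k = 1 → q k = 0 → testValue (s k) ≠ 0

/-- The integer whose binary digits, apart from the leading `1`, are the letters of a word,
least significant first. -/
def wordCode : List Bool → ℕ
  | [] => 1
  | b :: L => 2 * wordCode L + b.toNat

lemma wordCode_pos (L : List Bool) : 0 < wordCode L := by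
  induction L with
  | nil => simp [wordCode]
  | cons b L ih => simp only [wordCode]; omega

lemma exists_wordCode_eq (N : ℕ) (hN : 0 < N) : ∃ L, wordCode L = N := by
  induction N using Nat.strong_induction_on with
  | _ N ih =>
    by_cases h1 : N = 1
    · exact ⟨[], h1.symm⟩
    obtain ⟨L, hL⟩ := ih (N / 2) (by omega) (by omega)
    rcases Nat.mod_two_eq_zero_or_one N with h | h
    · exact ⟨false :: L, by simp [wordCode]; omega⟩
    · exact ⟨true :: L, by simp [wordCode]; omega⟩

namespace IsRun

variable {K : Type*} [Field K] {c : K} {n m q : ℕ → K} {s : ℕ → K × K × K}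

lemma exists_halved [CharZero K] (h : IsRun c n m q s) (r : ℕ) (hr : r ≤ 1) (i : ℕ) :
    ∀ k, m k = ((2 * i + r : ℕ) : K) →
      ∃ k', n k' = n k ∧ m k' = r ∧ q k' = q k + i ∧ s k' = s k := by
  induction i with
  | zero => intro k hk; exact ⟨k, by simpa using hk⟩
  | succ i ih =>
    intro k hk
    obtain ⟨h1, h2, h3, h4⟩ := h.halve k
      (by rw [hk]; exact_mod_cast (by omega : 2 * (i + 1) + r ≠ 0))
      (by rw [hk]; exact_mod_cast (by omega : 2 * (i + 1) + r ≠ 1))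
    obtain ⟨k', e1, e2, e3, e4⟩ := ih (k + 1) (by rw [h2, hk]; push_cast; ring)
    exact ⟨k', e1.trans h1, e2, by rw [e3, h3]; push_cast; ring, e4.trans h4⟩

lemma exists_read [CharZero K] (h : IsRun c n m q s) (L : List Bool) :
    ∀ k, m k = wordCode L → q k = 0 →
      ∃ k', n k' = n k ∧ m k' = 1 ∧ q k' = 0 ∧ s k' = L.foldl (readLetter c) (s k) := by
  induction L with
  | nil => intro k hk hq; exact ⟨k, by simpa [wordCode, hq] using hk⟩
  | cons b L ih =>
    intro k hk hq
    have hb : b.toNat ≤ 1 := by cases b <;> simp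
    obtain ⟨k₁, e1, e2, e3, e4⟩ := h.exists_halved b.toNat hb (wordCode L) k hk
    have hq₁ : q k₁ = wordCode L := by rw [e3, hq, zero_add]
    have hstep : n (k₁ + 1) = n k₁ ∧ m (k₁ + 1) = q k₁ ∧ q (k₁ + 1) = 0 ∧
        s (k₁ + 1) = readLetter c (s k₁) b := by
      cases b
      · exact h.even k₁ (by simpa using e2)
      · refine h.odd k₁ (by simpa using e2) ?_
        rw [hq₁]
        exact_mod_cast (wordCode_pos L).ne'
    obtain ⟨f1, f2, f3, f4⟩ := hstep
    obtain ⟨k', g1, g2, g3, g4⟩ := ih (k₁ + 1) (f2.trans hq₁) f3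
    exact ⟨k', by rw [g1, f1, e1], g2, g3, by rw [g4, f4, e4]; rfl⟩

lemma exists_start [CharZero K] (h : IsRun c n m q s) (hn : n 0 = 0) (hm : m 0 = 1) (hq : q 0 = 0)
    (N : ℕ) : ∃ k, n k = (N + 1 : ℕ) ∧ m k = (N + 1 : ℕ) ∧ q k = 0 ∧ s k = startState K := by
  induction N with
  | zero => exact ⟨1, by simpa [hn] using h.finish 0 hm hq⟩
  | succ N ih =>
    obtain ⟨k, e1, e2, e3, -⟩ := ih
    obtain ⟨L, hL⟩ := exists_wordCode_eq (N + 1) N.succ_pos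
    obtain ⟨k', f1, f2, f3, -⟩ := h.exists_read L k (by rw [e2, hL]) e3
    have := h.finish k' f2 f3
    rw [f1, e1] at this
    exact ⟨k' + 1, by exact_mod_cast this⟩

lemma testValue_foldl_ne_zero [CharZero K] (h : IsRun c n m q s)
    (hn : n 0 = 0) (hm : m 0 = 1) (hq : q 0 = 0) (L : List Bool) :
    testValue (L.foldl (readLetter c) (startState K)) ≠ 0 := by
  obtain ⟨k, -, e2, e3, e4⟩ := h.exists_start hn hm hq (wordCode L - 1)
  rw [Nat.sub_add_cancel (wordCode_pos L)] at e2
  obtain ⟨k', -, f2, f3, f4⟩ := h.exists_read L k e2 e3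
  rw [← e4, ← f4]
  exact h.test_ne_zero k' f2 f3

end IsRun

section Words

variable {R : Type*} [CommRing R]

/-- States reachable from `startState` by reading a word. -/
def Reachable (c : R) (s : R × R × R) : Prop :=
  ∃ L : List Bool, L.foldl (readLetter c) (startState R) = s

lemma Reachable.read {c : R} {s : R × R × R} (h : Reachable c s) (b : Bool) :
    Reachable c (readLetter c s b) := by
  obtain ⟨L, rfl⟩ := h
  exact ⟨L ++ [b], by simp⟩

lemma Reachable.skip {c a w v : R} (h : Reachable c (a, w, v)) : Reachable c (a, v, c * w) :=
  h.read false

lemma Reachable.add_nsmul {c a w v : R} (h : Reachable c (a, w, v)) (k : ℕ) :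
    Reachable c (a + k * w, w, v) := by
  induction k with
  | zero => simpa using h
  | succ k ih =>
    have := ih.read true
    simp only [readLetter] at this
    convert this using 2
    push_cast; ring

lemma reachable_sum (c : R) (p : ℕ → ℤ) (j : ℕ) :
    Reachable c (∑ i ∈ Finset.range j, (p i : R) * c ^ i, c ^ j, -c ^ j) := by
  induction j with
  | zero => exact ⟨[], by simp [startState]⟩
  | succ j ih =>
    rw [Finset.sum_range_succ]
    rcases Int.eq_nat_or_neg (p j) with ⟨k, hk | hk⟩
    · have := (ih.add_nsmul k).skip.skip
      convert this using 2
      · rw [hk]; push_cast; ring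
      · ext <;> simp <;> ring
    · have := (ih.skip.add_nsmul k).skip
      convert this using 2
      · rw [hk]; push_cast; ring
      · ext <;> simp <;> ring

lemma exists_testValue_foldl_eq_zero {c : R} (hc : IsAlgebraic ℤ c) :
    ∃ L : List Bool, testValue (L.foldl (readLetter c) (startState R)) = 0 := by
  obtain ⟨P, hP, hlead⟩ : ∃ P : Polynomial ℤ, Polynomial.aeval c P = 0 ∧
      0 < P.leadingCoeff := by
    obtain ⟨P, hP0, hP⟩ := hc
    rcases lt_or_gt_of_ne (Polynomial.leadingCoeff_ne_zero.2 hP0) with h | h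
    · exact ⟨-P, by simp [hP], by simpa using h⟩
    · exact ⟨P, hP, h⟩
  obtain ⟨k, hk⟩ : ∃ k : ℕ, P.coeff P.natDegree = k + 1 :=
    ⟨(P.leadingCoeff - 1).toNat, by rw [Polynomial.coeff_natDegree]; omega⟩
  obtain ⟨L, hL⟩ := (reachable_sum c P.coeff P.natDegree).add_nsmul k
  refine ⟨L, ?_⟩
  rw [hL]
  rw [Polynomial.aeval_eq_sum_range, Finset.sum_range_succ, hk] at hP
  simp only [zsmul_eq_mul] at hP
  simp only [testValue]
  rw [← hP]
  push_cast; ring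

end Words

section Transcendental

open Polynomial

/-- Leading-term information on the states reachable with `c = X`. -/
def HasLeadingTerms {K : Type*} [Field K] (s : K[X] × K[X] × K[X]) : Prop :=
  ∃ j : ℕ, s.1.natDegree ≤ j ∧
    ((s.2.1 = X ^ j ∧ s.2.2 = -X ^ j ∧ ∃ k : ℕ, s.1.coeff j = k) ∨
      (s.2.1 = -X ^ j ∧ s.2.2 = X ^ (j + 1)))

variable {K : Type*} [Field K]

lemma hasLeadingTerms_startState : HasLeadingTerms (startState K[X]) :=
  ⟨0, by simp [startState],
    Or.inl ⟨by simp [startState], by simp [startState], 0, by simp [startState]⟩⟩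

lemma HasLeadingTerms.readLetter {s : K[X] × K[X] × K[X]} (h : HasLeadingTerms s) (b : Bool) :
    HasLeadingTerms (readLetter X s b) := by
  obtain ⟨a, w, v⟩ := s
  obtain ⟨j, hd, ⟨rfl, rfl, k, hk⟩ | ⟨rfl, rfl⟩⟩ := h <;> cases b
  · exact ⟨j, hd, Or.inr ⟨rfl, (pow_succ' X j).symm⟩⟩
  · exact ⟨j, (natDegree_add_le _ _).trans (max_le hd (by simp)),
      Or.inl ⟨rfl, rfl, k + 1, by simpa [_root_.readLetter] using hk⟩⟩
  · refine ⟨j + 1, Nat.le_succ_of_le hd, Or.inl ⟨rfl, ?_, 0, ?_⟩⟩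
    · simp only [_root_.readLetter]; ring
    · simpa [_root_.readLetter] using coeff_eq_zero_of_natDegree_lt (Nat.lt_succ_of_le hd)
  · exact ⟨j, (natDegree_add_le _ _).trans (max_le hd (by simp)), Or.inr ⟨rfl, rfl⟩⟩

lemma HasLeadingTerms.testValue_ne_zero [CharZero K] {s : K[X] × K[X] × K[X]}
    (h : HasLeadingTerms s) : testValue s ≠ 0 := by
  obtain ⟨a, w, v⟩ := s
  obtain ⟨j, hd, ⟨rfl, rfl, k, hk⟩ | ⟨rfl, rfl⟩⟩ := h <;> intro h0
  · have h1 : a + X ^ j = 0 := by rw [← h0]; simp only [testValue]; ring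
    have h2 := congrArg (coeff · j) h1
    simp only [coeff_add, coeff_X_pow_self, coeff_zero] at h2
    simp only at hk
    rw [hk] at h2
    exact Nat.cast_add_one_ne_zero k h2
  · have h1 : a - (C 2 * X ^ j) + X ^ (j + 1) = 0 := by
      rw [← h0]; simp only [testValue, map_ofNat]; ring
    have h2 := congrArg (coeff · (j + 1)) h1
    simp only [coeff_add, coeff_sub, coeff_C_mul, coeff_X_pow, coeff_zero,
      coeff_eq_zero_of_natDegree_lt (Nat.lt_succ_of_le hd)] at h2
    simp at h2

end Transcendental

section Machine

variable {K : Type*} [Field K]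

open Classical in
/-- One step of the machine described by `IsRun`. -/
noncomputable def machineStep (c : K) (t : (K × K × K) × K × K × K) : (K × K × K) × K × K × K :=
  if t.1.2.1 = 0 then ((t.1.1, t.1.2.2, 0), readLetter c t.2 false)
  else if t.1.2.1 = 1 then
    if t.1.2.2 = 0 then ((t.1.1 + 1, t.1.1 + 1, 0), startState K)
    else ((t.1.1, t.1.2.2, 0), readLetter c t.2 true)
  else ((t.1.1, t.1.2.1 - 2, t.1.2.2 + 1), t.2)

lemma exists_isRun (c : K) (p : K × K × K → Prop) (hstart : p (startState K))
    (hread : ∀ s b, p s → p (readLetter c s b)) (htest : ∀ s, p s → testValue s ≠ 0) :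
    ∃ n m q s, IsRun c n m q s ∧ n 0 = 0 ∧ m 0 = 1 ∧ q 0 = 0 := by
  let t : ℕ → (K × K × K) × K × K × K := fun k =>
    (machineStep c)^[k] ((0, 1, 0), startState K)
  have ht : ∀ k, t (k + 1) = machineStep c (t k) := fun k =>
    Function.iterate_succ_apply' _ _ _
  have hp : ∀ k, p (t k).2 := by
    intro k
    induction k with
    | zero => exact hstart
    | succ k ih =>
      rw [ht, machineStep]
      split_ifs
      exacts [hread _ false ih, hstart, hread _ true ih, ih]
  refine ⟨fun k => (t k).1.1, fun k => (t k).1.2.1, fun k => (t k).1.2.2, fun k => (t k).2,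
    ⟨?_, ?_, ?_, ?_, fun k _ _ => htest _ (hp k)⟩, rfl, rfl, rfl⟩
  · intro k h0 h1
    simp only [ht, machineStep, if_neg h0, if_neg h1, and_self]
  · intro k h0
    simp only [ht, machineStep, if_pos h0, and_self]
  · intro k h1 h2
    simp only [ht, machineStep, h1, one_ne_zero, if_false, if_true, if_neg h2, and_self]
  · intro k h1 h2
    simp only [ht, machineStep, h1, h2, one_ne_zero, if_false, if_true, and_self]

open Polynomial in
lemma exists_isRun_fractionRing [CharZero K] :
    ∃ n m q s, IsRun (algebraMap K[X] (FractionRing K[X]) X) n m q s ∧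
      n 0 = 0 ∧ m 0 = 1 ∧ q 0 = 0 := by
  let f := algebraMap K[X] (FractionRing K[X])
  refine exists_isRun (f X)
    (fun s => ∃ s' : K[X] × K[X] × K[X], HasLeadingTerms s' ∧ s = (f s'.1, f s'.2.1, f s'.2.2))
    ⟨_, hasLeadingTerms_startState, by simp [startState]⟩ ?_ ?_
  · rintro _ b ⟨s', h, rfl⟩
    refine ⟨_, h.readLetter b, ?_⟩
    cases b <;> simp [readLetter]
  · rintro _ ⟨s', h, rfl⟩ h0
    refine h.testValue_ne_zero (IsFractionRing.injective K[X] (FractionRing K[X]) ?_)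
    rw [map_zero, ← h0]
    simp [testValue, f, map_ofNat (algebraMap K[X] (FractionRing K[X])) 2]

end Machine

section System

variable {R : Type*} [CommRing R]

/-- The difference equations describing `IsRun`, for the current values `x` and the next values
`y` of the variables. The variables are a marker `x 0`, which can be nonzero only at the beginning
of a run, the constant `c = x 1`, the registers `n, m, q, a, w, v = x 2, …, x 7`, and partial
inverses `x 8, …, x 11` of `m`, `m - 1`, `q` and of the test value. -/
def runSystem (x y : Fin 12 → R) : Fin 14 → R :=
  let isZero := 1 - x 3 * x 8
  let isOne := 1 - (x 3 - 1) * x 9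
  let isFinal := isOne * (1 - x 4 * x 10)
  ![x 0 * x 2, x 0 * (x 3 - 1), x 0 * x 4,
    x 3 * isZero, (x 3 - 1) * isOne, x 4 * (1 - x 4 * x 10),
    isFinal * (1 - (x 5 + 2 * x 6 + x 7) * x 11),
    y 1 - x 1,
    y 2 - (x 2 + isFinal),
    y 3 - ((1 - isZero - isOne) * (x 3 - 2) + (isZero + isOne - isFinal) * x 4
      + isFinal * (x 2 + 1)),
    y 4 - (1 - isZero - isOne) * (x 4 + 1),
    y 5 - (x 5 + (isOne - isFinal) * x 6 - isFinal * x 5),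
    y 6 - (isZero * x 7 + isFinal + (1 - isZero - isFinal) * x 6),
    y 7 - (isZero * (x 1 * x 6) - isFinal + (1 - isZero - isFinal) * x 7)]

lemma map_runSystem {S : Type*} [CommRing S] (f : R →+* S) (x y : Fin 12 → R) (i : Fin 14) :
    f (runSystem x y i) = runSystem (fun j => f (x j)) (fun j => f (y j)) i := by
  fin_cases i <;> simp [runSystem, map_ofNat f 2]

variable {K : Type*} [Field K]

lemma isRun_of_runSystem (x : ℕ → Fin 12 → K)
    (h : ∀ k i, runSystem (x k) (x (k + 1)) i = 0) :
    IsRun (x 0 1) (fun k => x k 2) (fun k => x k 3) (fun k => x k 4)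
      (fun k => (x k 5, x k 6, x k 7)) := by
  have hc : ∀ k, x k 1 = x 0 1 := by
    intro k
    induction k with
    | zero => rfl
    | succ k ih => rw [← ih]; exact sub_eq_zero.1 (h k 7)
  have key : ∀ k, ∃ isZero isOne isFinal : K,
      (x k 3 = 0 → isZero = 1) ∧ (x k 3 ≠ 0 → isZero = 0) ∧
      (x k 3 = 1 → isOne = 1) ∧ (x k 3 ≠ 1 → isOne = 0) ∧
      (x k 4 = 0 → isFinal = isOne) ∧ (x k 4 ≠ 0 → isFinal = 0) ∧
      isFinal * (1 - (x k 5 + 2 * x k 6 + x k 7) * x k 11) = 0 ∧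
      x (k + 1) 2 = x k 2 + isFinal ∧
      x (k + 1) 3 = (1 - isZero - isOne) * (x k 3 - 2) + (isZero + isOne - isFinal) * x k 4
        + isFinal * (x k 2 + 1) ∧
      x (k + 1) 4 = (1 - isZero - isOne) * (x k 4 + 1) ∧
      x (k + 1) 5 = x k 5 + (isOne - isFinal) * x k 6 - isFinal * x k 5 ∧
      x (k + 1) 6 = isZero * x k 7 + isFinal + (1 - isZero - isFinal) * x k 6 ∧
      x (k + 1) 7 = isZero * (x 0 1 * x k 6) - isFinal + (1 - isZero - isFinal) * x k 7 := by
    intro k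
    refine ⟨1 - x k 3 * x k 8, 1 - (x k 3 - 1) * x k 9,
      (1 - (x k 3 - 1) * x k 9) * (1 - x k 4 * x k 10), fun e => by simp [e],
      fun e => (mul_eq_zero.1 (h k 3)).resolve_left e, fun e => by simp [e],
      fun e => (mul_eq_zero.1 (h k 4)).resolve_left (sub_ne_zero.2 e), fun e => by simp [e],
      fun e => ?_, h k 6, sub_eq_zero.1 (h k 8), sub_eq_zero.1 (h k 9), sub_eq_zero.1 (h k 10),
      sub_eq_zero.1 (h k 11), sub_eq_zero.1 (h k 12), ?_⟩
    · rw [(mul_eq_zero.1 (h k 5)).resolve_left e, mul_zero]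
    · rw [← hc k]
      exact sub_eq_zero.1 (h k 13)
  constructor <;> intro k <;>
    obtain ⟨α, β, δ, hα, hα', hβ, hβ', hδ, hδ', ht, e2, e3, e4, e5, e6, e7⟩ := key k
  · intro h0 h1
    have hα0 := hα' h0
    have hβ0 := hβ' h1
    have hδ0 : δ = 0 := by
      by_cases hq : x k 4 = 0
      · rw [hδ hq, hβ0]
      · exact hδ' hq
    simp [e2, e3, e4, e5, e6, e7, hα0, hβ0, hδ0]
  · intro h0
    have hβ0 := hβ' (by rw [h0]; exact zero_ne_one)
    have hδ0 : δ = 0 := by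
      by_cases hq : x k 4 = 0
      · rw [hδ hq, hβ0]
      · exact hδ' hq
    simp [e2, e3, e4, e5, e6, e7, hα h0, hβ0, hδ0, readLetter]
  · intro h1 hq
    have hα0 := hα' (by rw [h1]; exact one_ne_zero)
    simp [e2, e3, e4, e5, e6, e7, hα0, hβ h1, hδ' hq, readLetter]
  · intro h1 hq
    have hα0 := hα' (by rw [h1]; exact one_ne_zero)
    simp [e2, e3, e4, e5, e6, e7, hα0, hβ h1, (hδ hq).trans (hβ h1), startState]
  · intro h1 hq h0
    simp only [testValue] at h0
    rw [(hδ hq).trans (hβ h1), h0] at ht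
    simp at ht

/-- The values of the variables of `runSystem` along a run. -/
noncomputable def runValues (c : K) (n m q : ℕ → K) (s : ℕ → K × K × K) (k : ℕ) : Fin 12 → K :=
  ![if k = 0 then 1 else 0, c, n k, m k, q k, (s k).1, (s k).2.1, (s k).2.2,
    (m k)⁻¹, (m k - 1)⁻¹, (q k)⁻¹, (testValue (s k))⁻¹]

lemma IsRun.runSystem_runValues {c : K} {n m q : ℕ → K} {s : ℕ → K × K × K}
    (h : IsRun c n m q s) (hn : n 0 = 0) (hm : m 0 = 1) (hq : q 0 = 0) (k : ℕ) (i : Fin 14) :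
    runSystem (runValues c n m q s k) (runValues c n m q s (k + 1)) i = 0 := by
  have hmul : ∀ a : K, a * (1 - a * a⁻¹) = 0 := fun a => by
    by_cases ha : a = 0 <;> simp [ha]
  have hcase : ∀ {i}, 7 ≤ i →
      runSystem (runValues c n m q s k) (runValues c n m q s (k + 1)) i = 0 := by
    intro i hi
    by_cases h0 : m k = 0
    · obtain ⟨e1, e2, e3, e4⟩ := h.even k h0
      fin_cases i <;> simp at hi <;>
        simp [runSystem, runValues, h0, e1, e2, e3, e4, readLetter]
    by_cases h1 : m k = 1
    · by_cases h2 : q k = 0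
      · obtain ⟨e1, e2, e3, e4⟩ := h.finish k h1 h2
        fin_cases i <;> simp at hi <;>
          simp [runSystem, runValues, h1, h2, e1, e2, e3, e4, startState]
      · obtain ⟨e1, e2, e3, e4⟩ := h.odd k h1 h2
        fin_cases i <;> simp at hi <;>
          simp [runSystem, runValues, h1, h2, e1, e2, e3, e4, readLetter]
    · obtain ⟨e1, e2, e3, e4⟩ := h.halve k h0 h1
      have h1' : m k - 1 ≠ 0 := sub_ne_zero.2 h1
      fin_cases i <;> simp at hi <;>
        simp [runSystem, runValues, h0, h1', e1, e2, e3, e4]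
  by_cases hi : 7 ≤ i
  · exact hcase hi
  fin_cases i <;> simp at hi
  · by_cases hk : k = 0 <;> simp [runSystem, runValues, hk, hn]
  · by_cases hk : k = 0 <;> simp [runSystem, runValues, hk, hm]
  · by_cases hk : k = 0 <;> simp [runSystem, runValues, hk, hq]
  · exact hmul (m k)
  · exact hmul (m k - 1)
  · exact hmul (q k)
  · by_cases h1 : m k = 1
    · by_cases h2 : q k = 0
      · have ht := mul_inv_cancel₀ (h.test_ne_zero k h1 h2)
        have ht' : 1 - ((s k).1 + 2 * (s k).2.1 + (s k).2.2) * (testValue (s k))⁻¹ = 0 :=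
          sub_eq_zero.2 ht.symm
        simp [runSystem, runValues, ht']
      · simp [runSystem, runValues, h2]
    · simp [runSystem, runValues, sub_ne_zero.2 h1]

end System

theorem stmt16 :
    ∃ (r : ℕ) (F : Finset (MvPolynomial (ℕ × Fin r) (AlgebraicClosure ℚ)))
      (g : MvPolynomial (ℕ × Fin r) (AlgebraicClosure ℚ)),
      (∀ x : Fin r → ℕ → AlgebraicClosure ℚ,
        (∀ f ∈ F, ∀ ℓ : ℕ,
          MvPolynomial.eval (fun p : ℕ × Fin r => x p.2 (ℓ + p.1)) f = 0) →
        ∀ ℓ : ℕ, MvPolynomial.eval (fun p : ℕ × Fin r => x p.2 (ℓ + p.1)) g = 0) ∧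
      g ∉ (Ideal.span {q : MvPolynomial (ℕ × Fin r) (AlgebraicClosure ℚ) |
        ∃ f ∈ F, ∃ i : ℕ,
          q = MvPolynomial.rename (fun p : ℕ × Fin r => (i + p.1, p.2)) f}).radical := by
  classical
  refine ⟨12, Finset.univ.image
    (runSystem (fun j => MvPolynomial.X (0, j)) (fun j => MvPolynomial.X (1, j))),
    MvPolynomial.X (0, 0), ?_, ?_⟩
  · intro x hx ℓ
    by_contra hne
    rw [MvPolynomial.eval_X] at hne
    have hsys : ∀ k i, runSystem (fun j => x j (ℓ + k)) (fun j => x j (ℓ + (k + 1))) i = 0 := by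
      intro k i
      have := hx _ (Finset.mem_image_of_mem _ (Finset.mem_univ i)) (ℓ + k)
      rw [map_runSystem] at this
      simpa [add_assoc] using this
    have hrun := isRun_of_runSystem (fun k j => x j (ℓ + k)) hsys
    have halg : IsAlgebraic ℤ (x 1 (ℓ + 0)) :=
      (IsFractionRing.isAlgebraic_iff ℤ ℚ (AlgebraicClosure ℚ)).2
        ((AlgebraicClosure.isAlgebraic ℚ).isAlgebraic _)
    obtain ⟨L, hL⟩ := exists_testValue_foldl_eq_zero halg
    exact hrun.testValue_foldl_ne_zero ((mul_eq_zero.1 (hsys 0 0)).resolve_left hne)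
      (sub_eq_zero.1 ((mul_eq_zero.1 (hsys 0 1)).resolve_left hne))
      ((mul_eq_zero.1 (hsys 0 2)).resolve_left hne) L hL
  · obtain ⟨n, m, q, s, hrun, hn, hm, hq⟩ :=
      exists_isRun_fractionRing (K := AlgebraicClosure ℚ)
    set y := runValues _ n m q s with hy
    let φ : MvPolynomial (ℕ × Fin 12) (AlgebraicClosure ℚ) →ₐ[AlgebraicClosure ℚ]
        FractionRing (Polynomial (AlgebraicClosure ℚ)) :=
      MvPolynomial.aeval fun p => y p.1 p.2
    have hle : Ideal.span {q : MvPolynomial (ℕ × Fin 12) (AlgebraicClosure ℚ) |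
        ∃ f ∈ Finset.univ.image
          (runSystem (fun j => MvPolynomial.X (0, j)) (fun j => MvPolynomial.X (1, j))),
        ∃ i : ℕ, q = MvPolynomial.rename (fun p : ℕ × Fin 12 => (i + p.1, p.2)) f} ≤
        RingHom.ker φ.toRingHom := by
      rw [Ideal.span_le]
      rintro _ ⟨f, hf, k, rfl⟩
      obtain ⟨i, -, rfl⟩ := Finset.mem_image.1 hf
      have := hrun.runSystem_runValues hn hm hq k i
      rw [← AlgHom.coe_toRingHom (MvPolynomial.rename _), map_runSystem, SetLike.mem_coe,
        RingHom.mem_ker, map_runSystem]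
      simpa [φ] using this
    intro hmem
    have hker := (RingHom.ker_isPrime φ.toRingHom).isRadical.radical_le_iff.2 hle hmem
    rw [RingHom.mem_ker] at hker
    simp [φ, hy, runValues] at hker
end
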